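/- arXiv:2502.19851 — 2 statements merged into one kernel-verified Lean document; each statement's English description precedes it below -/
import Mathlib

section
/- Let (X₁,Y₁),…,(Xₙ,Yₙ) be i.i.d. from P with Y ∈ [0,1], and let f: 𝒳 → [0,1] be a fixed measurable function. Define the plug-in estimator Δ̂_Cutoff(f) := sup over intervals I ⊆ [0,1] of |(1/n)·Σ_{i=1}^n (Y_i − f(X_i))·1{f(X_i) ∈ I}|. Then for any δ > 0, with probability at least 1 − δ: |Δ̂_Cutoff(f) − Δ_Cutoff(f)| ≤ (20 + √(2·log(1/δ)))/√n. -/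
open MeasureTheory Set

/-- Cutoff Calibration Error of `f` with respect to a joint distribution `P` of `(X,Y)`
on `𝒳 × ℝ`: supremum over intervals `I ⊆ [0,1]` of `|E_P[(Y − f(X))·1{f(X) ∈ I}]|`. -/
noncomputable def cutoffCEP {𝒳 : Type*} [MeasurableSpace 𝒳]
    (P : Measure (𝒳 × ℝ)) (f : 𝒳 → ℝ) : ℝ :=
  ⨆ I : {I : Set ℝ // I ⊆ Icc 0 1 ∧ I.OrdConnected},
    |∫ p, (p.2 - f p.1) * I.1.indicator (1 : ℝ → ℝ) (f p.1) ∂P|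

/-- Plug-in estimator of Cutoff Calibration Error from a sample `(X₁,Y₁),…,(X_m,Y_m)`:
`sup over intervals I ⊆ [0,1] of |(1/m)·Σᵢ (Yᵢ − f(Xᵢ))·1{f(Xᵢ) ∈ I}|`. -/
noncomputable def empCutoff {𝒳 : Type*} (f : 𝒳 → ℝ) {m : ℕ} (data : Fin m → 𝒳 × ℝ) : ℝ :=
  ⨆ I : {I : Set ℝ // I ⊆ Icc 0 1 ∧ I.OrdConnected},
    |(m : ℝ)⁻¹ * ∑ i, ((data i).2 - f (data i).1) * I.1.indicator (1 : ℝ → ℝ) (f (data i).1)|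

open ProbabilityTheory Filter Topology
open scoped NNReal

/-- **McDiarmid's inequality**, sub-Gaussian form: a bounded measurable function of `n` i.i.d.
variables which changes by at most `c` when one variable is changed is sub-Gaussian around its mean
with variance proxy `n * (c / 2) ^ 2`. -/
theorem hasSubgaussianMGF_of_bounded_differences {Ω : Type*} [MeasurableSpace Ω]
    (P : Measure Ω) [IsProbabilityMeasure P] (c : ℝ≥0) (B : ℝ) :
    ∀ (n : ℕ) (g : (Fin n → Ω) → ℝ), Measurable g → (∀ x, |g x| ≤ B) →
      (∀ x i y, |g x - g (Function.update x i y)| ≤ c) →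
      HasSubgaussianMGF (fun x ↦ g x - ∫ y, g y ∂Measure.pi fun _ ↦ P) (n * (c / 2) ^ 2)
        (Measure.pi fun _ : Fin n ↦ P) := by
  intro n
  induction n with
  | zero =>
    intro g _ _ _
    have h (x : Fin 0 → Ω) : g x - ∫ y, g y ∂Measure.pi (fun _ : Fin 0 ↦ P) = 0 := by
      have h' : ∀ y, g y = g x := fun y ↦ congrArg g (Subsingleton.elim _ _)
      simp [h']
    simp only [h, Nat.cast_zero, zero_mul]
    exact HasSubgaussianMGF.fun_zero
  | succ n ih =>
    intro g hg hB hd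
    set e := MeasurableEquiv.piFinSuccAbove (fun _ : Fin (n + 1) ↦ Ω) 0 with he
    have hmp := measurePreserving_piFinSuccAbove (fun _ : Fin (n + 1) ↦ P) 0
    set ν := Measure.pi (fun _ : Fin n ↦ P)
    set m := ∫ y, g y ∂Measure.pi fun _ : Fin (n + 1) ↦ P with hm
    have hecons (a : Ω) (y : Fin n → Ω) : e.symm (a, y) = Fin.cons a y := by
      simp [he, MeasurableEquiv.piFinSuccAbove]
      rfl
    have hGm : Measurable fun p ↦ g (e.symm p) := hg.comp e.symm.measurable
    have hint {F : (Fin (n + 1) → Ω) → ℝ} :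
        ∫ x, F x ∂Measure.pi (fun _ : Fin (n + 1) ↦ P) = ∫ p, F (e.symm p) ∂P.prod ν := by
      exact (hmp.symm e).integral_comp' F |>.symm
    have hmeas (a : Ω) : Measurable fun y ↦ g (e.symm (a, y)) :=
      hGm.comp measurable_prodMk_left
    have hGi : Integrable (fun p ↦ g (e.symm p)) (P.prod ν) :=
      Integrable.of_bound hGm.aestronglyMeasurable B (.of_forall fun p ↦ hB _)
    have hgi (a : Ω) : Integrable (fun y ↦ g (e.symm (a, y))) ν :=
      Integrable.of_bound (hmeas a).aestronglyMeasurable B (.of_forall fun p ↦ hB _)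
    set h : Ω → ℝ := fun a ↦ ∫ y, g (e.symm (a, y)) ∂ν with hh
    have hhm : Measurable h := hGm.stronglyMeasurable.integral_prod_right.measurable
    have hhB (a : Ω) : |h a| ≤ B := by
      have := norm_integral_le_of_norm_le_const (μ := ν) (f := fun y ↦ g (e.symm (a, y)))
        (C := B) (.of_forall fun y ↦ hB _)
      simpa using this
    have hhm' : m = ∫ a, h a ∂P := by
      rw [hm, hint, integral_prod _ hGi]
    have hhd (a b : Ω) : h a - h b ≤ c := by
      rw [hh, ← integral_sub (hgi a) (hgi b)]
      have : ∫ y, (g (e.symm (a, y)) - g (e.symm (b, y))) ∂ν ≤ ∫ _, (c : ℝ) ∂ν := by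
        refine integral_mono ((hgi a).sub (hgi b)) (integrable_const _) fun y ↦ ?_
        have := hd (e.symm (a, y)) 0 b
        rw [hecons, Fin.update_cons_zero, ← hecons, ← hecons] at this
        exact (abs_le.1 this).2
      simpa using this
    have hne : Nonempty Ω := P.nonempty_of_neZero
    have hhbdd : BddBelow (range h) := ⟨-B, by rintro _ ⟨a, rfl⟩; exact (abs_le.1 (hhB a)).1⟩
    have hhI (a : Ω) : h a ∈ Icc (⨅ a, h a) ((⨅ a, h a) + c) := by
      refine ⟨ciInf_le hhbdd a, ?_⟩
      have : h a - c ≤ ⨅ a, h a := le_ciInf fun b ↦ by linarith [hhd a b]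
      linarith
    have hhs : HasSubgaussianMGF (fun a ↦ h a - m) ((c / 2) ^ 2) P := by
      have := hasSubgaussianMGF_of_mem_Icc (μ := P) hhm.aemeasurable (.of_forall hhI)
      rw [← hhm'] at this
      simpa using this
    have hes (a : Ω) : HasSubgaussianMGF (fun y ↦ g (e.symm (a, y)) - h a)
        (n * (c / 2) ^ 2) ν := by
      refine ih (fun y ↦ g (e.symm (a, y))) (hmeas a) (fun y ↦ hB _) fun x i y ↦ ?_
      simp only [hecons, Fin.cons_update]
      exact hd _ _ _
    have hexp {α : Type _} [MeasurableSpace α] (μ : Measure α) [IsProbabilityMeasure μ]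
        (F : α → ℝ) (hF : Measurable F) (hFB : ∀ x, |F x| ≤ B) (t : ℝ) (s : ℝ) :
        Integrable (fun x ↦ Real.exp (t * (F x - s))) μ :=
      integrable_exp_mul_of_mem_Icc (a := -B - s) (b := B - s) (hF.sub_const s).aemeasurable
        (.of_forall fun x ↦ ⟨by linarith [(abs_le.1 (hFB x)).1], by linarith [(abs_le.1 (hFB x)).2]⟩)
    refine ⟨fun t ↦ hexp _ g hg hB t m, fun t ↦ ?_⟩
    have hGe := hexp (P.prod ν) (fun p ↦ g (e.symm p)) hGm (fun _ ↦ hB _) t m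
    calc mgf (fun x ↦ g x - m) (Measure.pi fun _ : Fin (n + 1) ↦ P) t
        = ∫ a, ∫ y, Real.exp (t * (g (e.symm (a, y)) - m)) ∂ν ∂P := by
          rw [mgf, hint, integral_prod _ hGe]
      _ ≤ ∫ a, Real.exp ((n * (c / 2) ^ 2) * t ^ 2 / 2) * Real.exp (t * (h a - m)) ∂P := by
          refine integral_mono hGe.integral_prod_left ((hexp P h hhm hhB t m).const_mul _)
            fun a ↦ ?_
          have h1 : ∀ y, Real.exp (t * (g (e.symm (a, y)) - m))
              = Real.exp (t * (g (e.symm (a, y)) - h a)) * Real.exp (t * (h a - m)) := by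
            intro y
            rw [← Real.exp_add]
            ring_nf
          simp only [h1, integral_mul_const]
          gcongr
          have := (hes a).mgf_le t
          simpa [mgf] using this
      _ ≤ Real.exp ((n * (c / 2) ^ 2) * t ^ 2 / 2) * Real.exp ((c / 2) ^ 2 * t ^ 2 / 2) := by
          rw [integral_const_mul]
          gcongr
          have := hhs.mgf_le t
          simpa [mgf] using this
      _ = _ := by
          rw [← Real.exp_add]
          push_cast
          ring_nf

/-- The sign attached to a unit of `ℤ`, as a real number. -/
noncomputable def sgn (u : ℤˣ) : ℝ := ((u : ℤ) : ℝ)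

lemma sgn_eq_one_or (u : ℤˣ) : sgn u = 1 ∨ sgn u = -1 := by
  rcases Int.units_eq_one_or u with rfl | rfl <;> simp [sgn]

lemma sgn_neg (u : ℤˣ) : sgn (-u) = -sgn u := by
  simp [sgn]

/-- Potential-function form of Doob's `L²` maximal inequality for Rademacher sums. -/
lemma exists_rademacher_maximal {ι : Type*} [Fintype ι] [DecidableEq ι] (w z : ι → ℝ)
    (s : Finset ι) :
    ∃ M : (ι → ℤˣ) → ℝ,
      (∀ ε t, |∑ i ∈ s with w i ≤ t, sgn (ε i) * z i| ≤ M ε) ∧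
      (∀ ε, ∀ a ∉ s, M (Function.update ε a (-ε a)) = M ε) ∧
      ∑ ε, (4 * (∑ i ∈ s, sgn (ε i) * z i) ^ 2 - 4 * M ε * |∑ i ∈ s, sgn (ε i) * z i|
        + 2 * M ε ^ 2) ≤ Fintype.card (ι → ℤˣ) * (4 * ∑ i ∈ s, z i ^ 2) := by
  induction s using Finset.induction_on_max_value w with
  | empty => exact ⟨fun _ ↦ 0, by simp, by simp, by simp⟩
  | insert a s ha hmax ih =>
    obtain ⟨M, hM, hinv, hsum⟩ := ih
    have hM0 (ε) : 0 ≤ M ε := (abs_nonneg _).trans (hM ε 0)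
    have hSinv (ε : ι → ℤˣ) (b : ι) (hb : b ∉ s) :
        ∑ i ∈ s, sgn (Function.update ε b (-ε b) i) * z i = ∑ i ∈ s, sgn (ε i) * z i := by
      refine Finset.sum_congr rfl fun i hi ↦ ?_
      rw [Function.update_of_ne (ne_of_mem_of_not_mem hi hb)]
    have hflip : Function.Involutive fun ε : ι → ℤˣ ↦ Function.update ε a (-ε a) := by
      intro ε
      simp
    refine ⟨fun ε ↦ max (M ε) |∑ i ∈ insert a s, sgn (ε i) * z i|, ?_, ?_, ?_⟩
    · intro ε t
      by_cases hat : w a ≤ t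
      · refine le_max_of_le_right (le_of_eq ?_)
        rw [Finset.filter_true_of_mem]
        intro i hi
        rcases Finset.mem_insert.1 hi with rfl | hi
        · exact hat
        · exact (hmax i hi).trans hat
      · refine le_max_of_le_left ?_
        rw [Finset.filter_insert, if_neg hat]
        exact hM ε t
    · intro ε b hb
      obtain ⟨hba, hbs⟩ : b ≠ a ∧ b ∉ s := by simpa using hb
      simp only [Finset.sum_insert ha, hinv ε b hbs, hSinv ε b hbs,
        Function.update_of_ne hba.symm]
    · set S : (ι → ℤˣ) → ℝ := fun ε ↦ ∑ i ∈ s, sgn (ε i) * z i with hS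
      simp only [Finset.sum_insert ha]
      set Ψ : (ι → ℤˣ) → ℝ := fun ε ↦ 4 * (sgn (ε a) * z a + S ε) ^ 2
        - 4 * M ε * |sgn (ε a) * z a + S ε| + 2 * M ε ^ 2 with hΨ
      have hpot (m x : ℝ) :
          4 * x ^ 2 - 4 * max m |x| * |x| + 2 * max m |x| ^ 2 ≤ 4 * x ^ 2 - 4 * m * |x| + 2 * m ^ 2 := by
        rcases le_total m |x| with h | h
        · rw [max_eq_right h]
          nlinarith [sq_nonneg (m - |x|)]
        · rw [max_eq_left h]
      have hΨflip : ∑ ε, Ψ (Function.update ε a (-ε a)) = ∑ ε, Ψ ε :=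
        Equiv.sum_comp hflip.toPerm Ψ
      have hpair (ε) : Ψ ε + Ψ (Function.update ε a (-ε a)) ≤
          2 * (4 * S ε ^ 2 - 4 * M ε * |S ε| + 2 * M ε ^ 2) + 8 * z a ^ 2 := by
        have h1 : S (Function.update ε a (-ε a)) = S ε := hSinv ε a ha
        simp only [hΨ, h1, hinv ε a ha, Function.update_self, sgn_neg]
        have hsq : sgn (ε a) ^ 2 = 1 := by
          rcases sgn_eq_one_or (ε a) with h | h <;> simp [h]
        have habs : 2 * |S ε| ≤ |sgn (ε a) * z a + S ε| + |-sgn (ε a) * z a + S ε| := by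
          have := abs_add_le (sgn (ε a) * z a + S ε) (-sgn (ε a) * z a + S ε)
          rw [show sgn (ε a) * z a + S ε + (-sgn (ε a) * z a + S ε) = 2 * S ε by ring,
            abs_mul, abs_two] at this
          exact this
        have := mul_le_mul_of_nonneg_left habs (hM0 ε)
        have h2 : (sgn (ε a) * z a) ^ 2 = z a ^ 2 := by rw [mul_pow, hsq, one_mul]
        nlinarith
      have htot : ∑ ε, Ψ ε + ∑ ε, Ψ ε ≤
          2 * ∑ ε, (4 * S ε ^ 2 - 4 * M ε * |S ε| + 2 * M ε ^ 2)
            + Fintype.card (ι → ℤˣ) * (8 * z a ^ 2) := by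
        calc ∑ ε, Ψ ε + ∑ ε, Ψ ε = ∑ ε, (Ψ ε + Ψ (Function.update ε a (-ε a))) := by
              rw [Finset.sum_add_distrib (f := Ψ), hΨflip]
          _ ≤ ∑ ε, (2 * (4 * S ε ^ 2 - 4 * M ε * |S ε| + 2 * M ε ^ 2) + 8 * z a ^ 2) :=
              Finset.sum_le_sum fun ε _ ↦ hpair ε
          _ = _ := by
              rw [Finset.sum_add_distrib (g := fun _ ↦ 8 * z a ^ 2), ← Finset.mul_sum,
                Finset.sum_const, Finset.card_univ, nsmul_eq_mul]
      refine (Finset.sum_le_sum fun ε _ ↦ hpot (M ε) (sgn (ε a) * z a + S ε)).trans ?_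
      change ∑ ε, Ψ ε ≤ _
      linarith

/-- Expected maximum of a Rademacher average over differences of half-lines. -/
lemma sum_iSup_rademacher_le {n : ℕ} (w z : Fin n → ℝ) (hz : ∀ i, |z i| ≤ 1) :
    ∑ ε : Fin n → ℤˣ, ⨆ q : ℚ × ℚ, |∑ i, sgn (ε i) * (z i *
        ((Iic (q.2 : ℝ)).indicator 1 (w i) - (Iic (q.1 : ℝ)).indicator 1 (w i)))|
      ≤ Fintype.card (Fin n → ℤˣ) * (4 * √n) := by
  obtain ⟨M, hM, -, hsum⟩ := exists_rademacher_maximal w z Finset.univ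
  set N : ℝ := (Fintype.card (Fin n → ℤˣ) : ℝ)
  have hsup (ε : Fin n → ℤˣ) : ⨆ q : ℚ × ℚ, |∑ i, sgn (ε i) * (z i *
        ((Iic (q.2 : ℝ)).indicator 1 (w i) - (Iic (q.1 : ℝ)).indicator 1 (w i)))| ≤ 2 * M ε := by
    refine ciSup_le fun q ↦ ?_
    have h (t : ℝ) : ∑ i, sgn (ε i) * (z i * (Iic t).indicator 1 (w i))
        = ∑ i with w i ≤ t, sgn (ε i) * z i := by
      rw [Finset.sum_filter]
      refine Finset.sum_congr rfl fun i _ ↦ ?_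
      by_cases hi : w i ≤ t <;> simp [hi]
    simp only [mul_sub, Finset.sum_sub_distrib, h]
    refine (abs_sub _ _).trans ?_
    linarith [hM ε q.1, hM ε q.2]
  have hMsq : ∑ ε, M ε ^ 2 ≤ N * (4 * n) := by
    refine le_trans (Finset.sum_le_sum fun ε _ ↦ ?_)
      (hsum.trans (mul_le_mul_of_nonneg_left ?_ (Nat.cast_nonneg _)))
    · nlinarith [sq_nonneg (2 * |∑ i, sgn (ε i) * z i| - M ε), sq_abs (∑ i, sgn (ε i) * z i)]
    · have : ∑ i, z i ^ 2 ≤ ∑ _i : Fin n, (1 : ℝ) :=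
        Finset.sum_le_sum fun i _ ↦ (sq_le_one_iff_abs_le_one _).2 (hz i)
      simp only [Finset.sum_const, Finset.card_univ, Fintype.card_fin, nsmul_eq_mul, mul_one] at this
      linarith
  have hMsum : ∑ ε, M ε ≤ N * (2 * √n) := by
    refine le_of_sq_le_sq ?_ (by positivity)
    have := sq_sum_le_card_mul_sum_sq (s := Finset.univ) (f := M)
    rw [Finset.card_univ] at this
    calc _ ≤ N * ∑ ε, M ε ^ 2 := this
      _ ≤ N * (N * (4 * n)) := by gcongr
      _ = _ := by
        rw [mul_pow, mul_pow, Real.sq_sqrt (Nat.cast_nonneg _)]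
        ring
  calc _ ≤ ∑ ε, 2 * M ε := Finset.sum_le_sum fun ε _ ↦ hsup ε
    _ ≤ _ := by
      rw [← Finset.mul_sum]
      linarith

/-- Uniform deviation of the empirical means of a function class from their expectations. -/
noncomputable def uniformDeviation {Ω J : Type*} [MeasurableSpace Ω] (P : Measure Ω)
    (φ : J → Ω → ℝ) {n : ℕ} (x : Fin n → Ω) : ℝ :=
  ⨆ j, |(n : ℝ)⁻¹ * ∑ i, φ j (x i) - ∫ ω, φ j ω ∂P|

lemma abs_sum_le_of_abs_le {n : ℕ} {b : ℝ} {u : Fin n → ℝ} (hu : ∀ i, |u i| ≤ b) :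
    |∑ i, u i| ≤ n * b :=
  (Finset.abs_sum_le_sum_abs _ _).trans
    ((Finset.sum_le_sum fun i _ ↦ hu i).trans (by simp))

lemma measurable_uniformDeviation {Ω J : Type*} [MeasurableSpace Ω] {P : Measure Ω}
    {φ : J → Ω → ℝ} [Countable J] (hφ : ∀ j, Measurable (φ j)) {n : ℕ} :
    Measurable (uniformDeviation P φ (n := n)) := by
  refine Measurable.iSup fun j ↦ ?_
  have := hφ j
  fun_prop

section UniformDeviation

variable {Ω J : Type*} [MeasurableSpace Ω] {P : Measure Ω} [IsProbabilityMeasure P]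
  {φ : J → Ω → ℝ}

lemma abs_integral_le_one (hφ1 : ∀ j ω, |φ j ω| ≤ 1) (j : J) : |∫ ω, φ j ω ∂P| ≤ 1 := by
  simpa using norm_integral_le_of_norm_le_const (μ := P) (f := φ j) (C := 1)
    (.of_forall fun ω ↦ hφ1 j ω)

lemma abs_deviation_le_two (hφ1 : ∀ j ω, |φ j ω| ≤ 1) {n : ℕ} (x : Fin n → Ω) (j : J) :
    |(n : ℝ)⁻¹ * ∑ i, φ j (x i) - ∫ ω, φ j ω ∂P| ≤ 2 := by
  refine (abs_sub _ _).trans ?_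
  have h1 := abs_integral_le_one (P := P) hφ1 j
  have h2 : |(n : ℝ)⁻¹ * ∑ i, φ j (x i)| ≤ 1 := by
    rw [abs_mul, abs_inv, Nat.abs_cast]
    have := abs_sum_le_of_abs_le fun i ↦ hφ1 j (x i)
    rcases Nat.eq_zero_or_pos n with rfl | hn
    · simp
    · rw [inv_mul_le_iff₀ (by positivity)]
      exact this
  linarith

lemma bddAbove_deviation (hφ1 : ∀ j ω, |φ j ω| ≤ 1) {n : ℕ} (x : Fin n → Ω) :
    BddAbove (range fun j ↦ |(n : ℝ)⁻¹ * ∑ i, φ j (x i) - ∫ ω, φ j ω ∂P|) :=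
  ⟨2, by rintro _ ⟨j, rfl⟩; exact abs_deviation_le_two hφ1 x j⟩

lemma abs_uniformDeviation_le_two [Nonempty J] (hφ1 : ∀ j ω, |φ j ω| ≤ 1) {n : ℕ}
    (x : Fin n → Ω) : |uniformDeviation P φ x| ≤ 2 := by
  rw [uniformDeviation, abs_of_nonneg (Real.iSup_nonneg fun _ ↦ abs_nonneg _)]
  exact ciSup_le fun j ↦ abs_deviation_le_two hφ1 x j

lemma uniformDeviation_sub_update_le [Nonempty J] (hφ1 : ∀ j ω, |φ j ω| ≤ 1) {n : ℕ}
    (x : Fin n → Ω) (i : Fin n) (y : Ω) :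
    |uniformDeviation P φ x - uniformDeviation P φ (Function.update x i y)| ≤ 2 / n := by
  have key (x : Fin n → Ω) (y : Ω) :
      uniformDeviation P φ x ≤ uniformDeviation P φ (Function.update x i y) + 2 / n := by
    refine ciSup_le fun j ↦ ?_
    refine le_trans ?_ (add_le_add_left (le_ciSup (bddAbove_deviation hφ1 _) j) _)
    have hsum : ∑ k, φ j (x k) - ∑ k, φ j (Function.update x i y k) = φ j (x i) - φ j y := by
      rw [← Finset.sum_sub_distrib, Finset.sum_eq_single i]
      · simp
      · intro k _ hk
        simp [Function.update_of_ne hk]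
      · simp
    have h2 : |(n : ℝ)⁻¹ * (φ j (x i) - φ j y)| ≤ 2 / n := by
      rw [abs_mul, abs_inv, Nat.abs_cast, inv_mul_eq_div]
      gcongr
      refine (abs_sub _ _).trans ?_
      linarith [hφ1 j (x i), hφ1 j y]
    rw [← hsum] at h2
    set A := ∑ k, φ j (x k)
    set A' := ∑ k, φ j (Function.update x i y k)
    calc |(n : ℝ)⁻¹ * A - ∫ ω, φ j ω ∂P|
        = |((n : ℝ)⁻¹ * A' - ∫ ω, φ j ω ∂P) + (n : ℝ)⁻¹ * (A - A')| := by ring_nf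
      _ ≤ _ := (abs_add_le _ _).trans (by gcongr)
  rw [abs_sub_le_iff]
  have h1 := key x y
  have h2 := key (Function.update x i y) (x i)
  simp only [Function.update_idem, Function.update_eq_self] at h2
  constructor <;> linarith

/-- **Symmetrization**: the expected uniform deviation is at most `2 / n` times a pointwise bound
on the expected supremum of Rademacher sums. -/
lemma integral_uniformDeviation_le [Countable J] [Nonempty J] (hφ : ∀ j, Measurable (φ j))
    (hφ1 : ∀ j ω, |φ j ω| ≤ 1) {n : ℕ} (hn : 0 < n) {C : ℝ}
    (hC : ∀ x : Fin n → Ω, ∑ ε : Fin n → ℤˣ, ⨆ j, |∑ i, sgn (ε i) * φ j (x i)|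
      ≤ Fintype.card (Fin n → ℤˣ) * C) :
    ∫ x, uniformDeviation P φ x ∂(Measure.pi fun _ : Fin n ↦ P) ≤ 2 * C / n := by
  set μ := Measure.pi fun _ : Fin n ↦ P
  set Q := Measure.pi fun _ : Fin n ↦ P.prod P
  set K : (Fin n → ℤˣ) → (Fin n → Ω × Ω) → ℝ :=
    fun ε y ↦ ⨆ j, |∑ i, sgn (ε i) * (φ j (y i).1 - φ j (y i).2)| with hK
  have hsgn (u : ℤˣ) : |sgn u| = 1 := by rcases sgn_eq_one_or u with h | h <;> simp [h]
  have hterm (ε : Fin n → ℤˣ) (y : Fin n → Ω × Ω) (j : J) :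
      |∑ i, sgn (ε i) * (φ j (y i).1 - φ j (y i).2)| ≤ n * 2 := by
    refine abs_sum_le_of_abs_le fun i ↦ ?_
    rw [abs_mul, hsgn, one_mul]
    refine (abs_sub _ _).trans ?_
    linarith [hφ1 j (y i).1, hφ1 j (y i).2]
  have hKbdd (ε : Fin n → ℤˣ) (y : Fin n → Ω × Ω) : BddAbove (range fun j ↦ |∑ i, sgn (ε i) * (φ j (y i).1 - φ j (y i).2)|) :=
    ⟨n * 2, by rintro _ ⟨j, rfl⟩; exact hterm ε y j⟩
  have hKm (ε) : Measurable (K ε) := by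
    refine Measurable.iSup fun j ↦ ?_
    have := hφ j
    fun_prop
  have hKB (ε y) : ‖K ε y‖ ≤ n * 2 := by
    rw [Real.norm_eq_abs, abs_of_nonneg (Real.iSup_nonneg fun _ ↦ abs_nonneg _)]
    exact ciSup_le fun j ↦ hterm ε y j
  have hKi (ε) : Integrable (K ε) Q :=
    Integrable.of_bound (hKm ε).aestronglyMeasurable _ (.of_forall (hKB ε))
  have hinv (ε) : ∫ y, K 1 y ∂Q = ∫ y, K ε y ∂Q := by
    set T : ∀ _ : Fin n, Ω × Ω → Ω × Ω := fun i ↦ if ε i = 1 then id else Prod.swap with hT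
    have hTmp : MeasurePreserving (fun y : Fin n → Ω × Ω ↦ fun i ↦ T i (y i)) Q Q := by
      refine measurePreserving_pi _ _ fun i ↦ ?_
      by_cases h : ε i = 1
      · simpa [hT, h] using MeasurePreserving.id (P.prod P)
      · simpa [hT, h] using Measure.measurePreserving_swap (μ := P) (ν := P)
    have hKT (y) : K 1 (fun i ↦ T i (y i)) = K ε y := by
      simp only [hK]
      congr! 4 with j i
      by_cases h : ε i = 1
      · simp [hT, h]
      · have h' : ε i = -1 := (Int.units_eq_one_or _).resolve_left h
        simp [hT, h', sgn]
    rw [← hTmp.map_eq, integral_map hTmp.measurable.aemeasurable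
      (by rw [hTmp.map_eq]; exact (hKm 1).aestronglyMeasurable), hTmp.map_eq]
    simp only [hKT]
  have hKavg (y : Fin n → Ω × Ω) : ∑ ε, K ε y ≤ Fintype.card (Fin n → ℤˣ) * (2 * C) := by
    have hHbdd (ε : Fin n → ℤˣ) (x : Fin n → Ω) :
        BddAbove (range fun j ↦ |∑ i, sgn (ε i) * φ j (x i)|) := by
      refine ⟨n * 1, ?_⟩
      rintro _ ⟨j, rfl⟩
      refine abs_sum_le_of_abs_le fun i ↦ ?_
      rw [abs_mul, hsgn, one_mul]
      exact hφ1 _ _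
    have hle (ε) : K ε y ≤ (⨆ j, |∑ i, sgn (ε i) * φ j (y i).1|)
        + ⨆ j, |∑ i, sgn (ε i) * φ j (y i).2| := by
      refine ciSup_le fun j ↦ ?_
      simp only [mul_sub, Finset.sum_sub_distrib]
      exact (abs_sub _ _).trans (add_le_add
        (le_ciSup (hHbdd ε fun i ↦ (y i).1) j) (le_ciSup (hHbdd ε fun i ↦ (y i).2) j))
    have := Finset.sum_le_sum fun ε (_ : ε ∈ Finset.univ) ↦ hle ε
    rw [Finset.sum_add_distrib] at this
    linarith [hC fun i ↦ (y i).1, hC fun i ↦ (y i).2]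
  have hK1 : ∫ y, K 1 y ∂Q ≤ 2 * C := by
    have h1 : Fintype.card (Fin n → ℤˣ) * ∫ y, K 1 y ∂Q ≤ Fintype.card (Fin n → ℤˣ) * (2 * C) := by
      calc _ = ∑ ε, ∫ y, K ε y ∂Q := by simp [← hinv]
        _ = ∫ y, ∑ ε, K ε y ∂Q := (integral_finsetSum _ fun ε _ ↦ hKi ε).symm
        _ ≤ ∫ _, (Fintype.card (Fin n → ℤˣ) * (2 * C) : ℝ) ∂Q :=
          integral_mono (integrable_finsetSum _ fun ε _ ↦ hKi ε) (integrable_const _) hKavg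
        _ = _ := by simp
    exact le_of_mul_le_mul_left h1 (by positivity)
  set e := MeasurableEquiv.arrowProdEquivProdArrow Ω Ω (Fin n)
  have hemp : MeasurePreserving e Q (μ.prod μ) :=
    measurePreserving_arrowProdEquivProdArrow Ω Ω (Fin n) (fun _ ↦ P) (fun _ ↦ P)
  have hK2i : Integrable (fun p ↦ K 1 (e.symm p)) (μ.prod μ) :=
    Integrable.of_bound ((hKm 1).comp e.symm.measurable).aestronglyMeasurable _
      (.of_forall fun p ↦ hKB 1 _)
  have hK2 : ∫ y, K 1 y ∂Q = ∫ x, ∫ x', K 1 (e.symm (x, x')) ∂μ ∂μ := by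
    rw [← integral_prod _ hK2i]
    exact (hemp.symm e).integral_comp' (K 1) |>.symm
  have hKx (x : Fin n → Ω) : Integrable (fun x' ↦ K 1 (e.symm (x, x'))) μ :=
    Integrable.of_bound (((hKm 1).comp e.symm.measurable).comp
      measurable_prodMk_left).aestronglyMeasurable _ (.of_forall fun p ↦ hKB 1 _)
  have hφi (j) (i : Fin n) : Integrable (fun x' : Fin n → Ω ↦ φ j (x' i)) μ :=
    Integrable.of_bound ((hφ j).comp (measurable_pi_apply i)).aestronglyMeasurable 1
      (.of_forall fun _ ↦ hφ1 _ _)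
  have hφint (j) (i : Fin n) : ∫ x', φ j (x' i) ∂μ = ∫ ω, φ j ω ∂P := by
    have hmp := measurePreserving_eval (fun _ : Fin n ↦ P) i
    rw [← hmp.map_eq, integral_map hmp.measurable.aemeasurable
      (hφ j).aestronglyMeasurable]
  have hpt (x : Fin n → Ω) :
      uniformDeviation P φ x ≤ (n : ℝ)⁻¹ * ∫ x', K 1 (e.symm (x, x')) ∂μ := by
    refine ciSup_le fun j ↦ ?_
    have h1 : (n : ℝ)⁻¹ * ∑ i, φ j (x i) - ∫ ω, φ j ω ∂P
        = (n : ℝ)⁻¹ * ∫ x', ∑ i, (φ j (x i) - φ j (x' i)) ∂μ := by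
      have hi (i : Fin n) : Integrable (fun x' : Fin n → Ω ↦ φ j (x i) - φ j (x' i)) μ :=
        (integrable_const _).sub (hφi j i)
      rw [integral_finsetSum _ fun i _ ↦ hi i]
      have (i : Fin n) : ∫ x', (φ j (x i) - φ j (x' i)) ∂μ = φ j (x i) - ∫ ω, φ j ω ∂P := by
        rw [integral_sub (integrable_const _) (hφi j i), hφint]
        simp
      simp only [this, Finset.sum_sub_distrib, Finset.sum_const, Finset.card_univ,
        Fintype.card_fin, nsmul_eq_mul]
      field_simp
    rw [h1, abs_mul, abs_inv, Nat.abs_cast]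
    gcongr
    refine (abs_integral_le_integral_abs).trans ?_
    refine integral_mono (integrable_finsetSum _ fun i _ ↦
      (integrable_const _).sub (hφi j i)).abs (hKx x) fun x' ↦ ?_
    have := le_ciSup (hKbdd 1 (e.symm (x, x'))) j
    refine le_trans (le_of_eq ?_) this
    simp [sgn, e, MeasurableEquiv.arrowProdEquivProdArrow, Equiv.arrowProdEquivProdArrow]
  have hUi : Integrable (uniformDeviation P φ (n := n)) μ :=
    Integrable.of_bound (measurable_uniformDeviation hφ).aestronglyMeasurable 2
      (.of_forall fun x ↦ abs_uniformDeviation_le_two hφ1 x)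
  calc ∫ x, uniformDeviation P φ x ∂μ
      ≤ ∫ x, (n : ℝ)⁻¹ * ∫ x', K 1 (e.symm (x, x')) ∂μ ∂μ :=
        integral_mono hUi (hK2i.integral_prod_left.const_mul _) hpt
    _ = (n : ℝ)⁻¹ * ∫ y, K 1 y ∂Q := by rw [integral_const_mul, hK2]
    _ ≤ (n : ℝ)⁻¹ * (2 * C) := by gcongr
    _ = _ := by ring

end UniformDeviation

lemma IsLowerSet.exists_seq_rat_tendsto_indicator {L : Set ℝ} (hL : IsLowerSet L)
    (hne : L.Nonempty) (hb : BddAbove L) :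
    ∃ u : ℕ → ℚ, ∀ x, Tendsto (fun k ↦ (Iic (u k : ℝ)).indicator (1 : ℝ → ℝ) x) atTop
      (𝓝 (L.indicator 1 x)) := by
  suffices h : ∃ u : ℕ → ℚ, ∀ x : ℝ, ∀ᶠ k in atTop, x ≤ (u k : ℝ) ↔ x ∈ L by
    obtain ⟨u, hu⟩ := h
    refine ⟨u, fun x ↦ tendsto_const_nhds.congr' ?_⟩
    filter_upwards [hu x] with k hk
    by_cases hx : x ∈ L
    · simp [hx, hk.2 hx]
    · simp [hx, mt hk.1 hx]
  have hlt {x : ℝ} (hx : x < sSup L) : x ∈ L := by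
    obtain ⟨y, hy, hxy⟩ := exists_lt_of_lt_csSup hne hx
    exact hL hxy.le hy
  by_cases ha : sSup L ∈ L
  · obtain ⟨u, -, hu, hlim⟩ := Rat.denseRange_cast.exists_seq_strictAnti_tendsto
      Rat.cast_mono (sSup L)
    refine ⟨u, fun x ↦ ?_⟩
    by_cases hx : x ∈ L
    · exact .of_forall fun k ↦ ⟨fun _ ↦ hx, fun _ ↦ (le_csSup hb hx).trans (hu k).le⟩
    · have hax : sSup L < x := lt_of_not_ge fun h ↦ hx (hL h ha)
      filter_upwards [hlim.eventually_lt_const hax] with k hk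
      exact ⟨fun h ↦ absurd hk (not_lt.2 h), fun h ↦ absurd h hx⟩
  · obtain ⟨u, -, hu, hlim⟩ := Rat.denseRange_cast.exists_seq_strictMono_tendsto
      Rat.cast_mono (sSup L)
    refine ⟨u, fun x ↦ ?_⟩
    by_cases hx : x ∈ L
    · have hxa : x < sSup L := lt_of_le_of_ne (le_csSup hb hx) fun h ↦ ha (h ▸ hx)
      filter_upwards [hlim.eventually_const_lt hxa] with k hk
      exact ⟨fun _ ↦ hx, fun _ ↦ le_of_lt hk⟩
    · exact .of_forall fun k ↦ ⟨fun h ↦ hlt (h.trans_lt (hu k)), fun h ↦ absurd h hx⟩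

/-- The indicator of a bounded interval is a pointwise limit of differences of indicators of
half-lines with rational endpoints. -/
lemma Set.OrdConnected.exists_seq_rat_tendsto_indicator {I : Set ℝ} (hI : I.OrdConnected)
    (ha : BddAbove I) (hb : BddBelow I) :
    ∃ u : ℕ → ℚ × ℚ, ∀ x, Tendsto (fun k ↦ (Iic ((u k).2 : ℝ)).indicator (1 : ℝ → ℝ) x
      - (Iic ((u k).1 : ℝ)).indicator 1 x) atTop (𝓝 (I.indicator 1 x)) := by
  rcases I.eq_empty_or_nonempty with rfl | hne
  · exact ⟨fun _ ↦ 0, by simp⟩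
  obtain ⟨c, hc⟩ := hb
  obtain ⟨y₀, hy₀⟩ := hne
  obtain ⟨v, hv⟩ := (lowerClosure I).lower.exists_seq_rat_tendsto_indicator
    ⟨y₀, subset_lowerClosure hy₀⟩ ha.lowerClosure
  have hL' : IsLowerSet {x | ∀ y ∈ I, x < y} := fun a b hba h y hy ↦ hba.trans_lt (h y hy)
  obtain ⟨u, hu⟩ := hL'.exists_seq_rat_tendsto_indicator
    ⟨c - 1, fun y hy ↦ by linarith [hc hy]⟩ ⟨y₀, fun x hx ↦ (hx y₀ hy₀).le⟩
  refine ⟨fun k ↦ (u k, v k), fun x ↦ ?_⟩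
  convert (hv x).sub (hu x) using 2
  by_cases hx : x ∈ I
  · have h1 : x ∈ (lowerClosure I : Set ℝ) := subset_lowerClosure hx
    have h2 : x ∉ {x | ∀ y ∈ I, x < y} := fun h ↦ lt_irrefl x (h x hx)
    rw [indicator_of_mem hx, indicator_of_mem h1, indicator_of_notMem h2]
    simp
  · by_cases h1 : x ∈ (lowerClosure I : Set ℝ)
    · obtain ⟨b, hbI, hxb⟩ := mem_lowerClosure.1 h1
      have h2 : x ∈ {x | ∀ y ∈ I, x < y} := fun y hy ↦
        lt_of_not_ge fun h ↦ hx (hI.out hy hbI ⟨h, hxb⟩)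
      rw [indicator_of_notMem hx, indicator_of_mem h1, indicator_of_mem h2]
      simp
    · have h2 : x ∉ {x | ∀ y ∈ I, x < y} := fun h ↦
        h1 (mem_lowerClosure.2 ⟨y₀, hy₀, (h y₀ hy₀).le⟩)
      rw [indicator_of_notMem hx, indicator_of_notMem h1, indicator_of_notMem h2]
      simp

lemma abs_ciSup_sub_ciSup_le {ι : Type*} [Nonempty ι] {a b : ι → ℝ} {d : ℝ}
    (ha : BddAbove (range a)) (hb : BddAbove (range b)) (h : ∀ i, |a i - b i| ≤ d) :
    |(⨆ i, a i) - ⨆ i, b i| ≤ d := by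
  have h1 : ⨆ i, a i ≤ (⨆ i, b i) + d := ciSup_le fun i ↦ by
    linarith [le_ciSup hb i, (abs_le.1 (h i)).2]
  have h2 : ⨆ i, b i ≤ (⨆ i, a i) + d := ciSup_le fun i ↦ by
    linarith [le_ciSup ha i, (abs_le.1 (h i)).1]
  rw [abs_sub_le_iff]
  constructor <;> linarith

section Cutoff

variable {𝒳 : Type*}

/-- The residual `Y - f(X)`, with `Y` clipped to `[0,1]`. -/
noncomputable def clippedResidual (f : 𝒳 → ℝ) (p : 𝒳 × ℝ) : ℝ :=
  max 0 (min 1 p.2) - f p.1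

/-- The residual restricted to the (signed) half-open interval with endpoints `q.1` and `q.2`. -/
noncomputable def cutoffClass (f : 𝒳 → ℝ) (q : ℚ × ℚ) (p : 𝒳 × ℝ) : ℝ :=
  clippedResidual f p *
    ((Iic (q.2 : ℝ)).indicator 1 (f p.1) - (Iic (q.1 : ℝ)).indicator 1 (f p.1))

lemma clippedResidual_eq (f : 𝒳 → ℝ) {p : 𝒳 × ℝ} (hp : p.2 ∈ Icc (0 : ℝ) 1) :
    clippedResidual f p = p.2 - f p.1 := by
  rw [clippedResidual, min_eq_right hp.2, max_eq_right hp.1]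

lemma abs_clippedResidual_le_one {f : 𝒳 → ℝ} (hf01 : ∀ x, f x ∈ Icc (0 : ℝ) 1) (p : 𝒳 × ℝ) :
    |clippedResidual f p| ≤ 1 := by
  have h1 : max 0 (min 1 p.2) ≤ 1 := max_le zero_le_one (min_le_left _ _)
  have h2 : 0 ≤ max 0 (min 1 p.2) := le_max_left _ _
  have h3 := hf01 p.1
  rw [clippedResidual, abs_le]
  constructor <;> linarith [h3.1, h3.2]

lemma abs_indicator_one_le (s : Set ℝ) (x : ℝ) : |s.indicator (1 : ℝ → ℝ) x| ≤ 1 := by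
  by_cases h : x ∈ s <;> simp [h]

lemma abs_indicator_Iic_sub_le (a b x : ℝ) :
    |(Iic b).indicator (1 : ℝ → ℝ) x - (Iic a).indicator 1 x| ≤ 1 := by
  by_cases h1 : x ≤ a <;> by_cases h2 : x ≤ b <;> simp [h1, h2]

lemma abs_cutoffClass_le_one {f : 𝒳 → ℝ} (hf01 : ∀ x, f x ∈ Icc (0 : ℝ) 1) (q : ℚ × ℚ)
    (p : 𝒳 × ℝ) : |cutoffClass f q p| ≤ 1 := by
  rw [cutoffClass, abs_mul]
  exact mul_le_one₀ (abs_clippedResidual_le_one hf01 p) (abs_nonneg _)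
    (abs_indicator_Iic_sub_le _ _ _)

variable [MeasurableSpace 𝒳]

lemma measurable_clippedResidual {f : 𝒳 → ℝ} (hf : Measurable f) :
    Measurable (clippedResidual f) := by
  unfold clippedResidual
  fun_prop

lemma measurable_cutoffClass {f : 𝒳 → ℝ} (hf : Measurable f) (q : ℚ × ℚ) :
    Measurable (cutoffClass f q) := by
  have h (t : ℝ) : Measurable fun p : 𝒳 × ℝ ↦ (Iic t).indicator (1 : ℝ → ℝ) (f p.1) :=
    (measurable_one.indicator measurableSet_Iic).comp (hf.comp measurable_fst)
  exact (measurable_clippedResidual hf).mul ((h _).sub (h _))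

lemma abs_empCutoff_sub_cutoffCEP_le {P : Measure (𝒳 × ℝ)} [IsProbabilityMeasure P]
    (hY : ∀ᵐ p ∂P, p.2 ∈ Icc (0 : ℝ) 1) {f : 𝒳 → ℝ} (hf : Measurable f)
    (hf01 : ∀ x, f x ∈ Icc (0 : ℝ) 1) {n : ℕ} (data : Fin n → 𝒳 × ℝ)
    (hdata : ∀ i, (data i).2 ∈ Icc (0 : ℝ) 1) :
    |empCutoff f data - cutoffCEP P f| ≤ uniformDeviation P (cutoffClass f) data := by
  have hne : Nonempty {I : Set ℝ // I ⊆ Icc 0 1 ∧ I.OrdConnected} :=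
    ⟨∅, empty_subset _, ordConnected_empty⟩
  have hint (I : Set ℝ) : ∫ p, (p.2 - f p.1) * I.indicator (1 : ℝ → ℝ) (f p.1) ∂P
      = ∫ p, clippedResidual f p * I.indicator (1 : ℝ → ℝ) (f p.1) ∂P := by
    refine integral_congr_ae ?_
    filter_upwards [hY] with p hp
    rw [clippedResidual_eq f hp]
  have hbd (I : Set ℝ) (p : 𝒳 × ℝ) :
      |clippedResidual f p * I.indicator (1 : ℝ → ℝ) (f p.1)| ≤ 1 := by
    rw [abs_mul]
    exact mul_le_one₀ (abs_clippedResidual_le_one hf01 p) (abs_nonneg _)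
      (abs_indicator_one_le _ _)
  simp only [empCutoff, cutoffCEP, hint, ← clippedResidual_eq f (hdata _)]
  refine abs_ciSup_sub_ciSup_le ⟨(n : ℝ)⁻¹ * (n * 1), ?_⟩ ⟨1, ?_⟩ fun I ↦
    (abs_abs_sub_abs_le_abs_sub _ _).trans ?_
  · rintro _ ⟨I, rfl⟩
    simp only [abs_mul, abs_inv, Nat.abs_cast]
    gcongr
    exact abs_sum_le_of_abs_le fun i ↦ hbd I.1 (data i)
  · rintro _ ⟨I, rfl⟩
    simpa using norm_integral_le_of_norm_le_const (μ := P) (C := 1)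
      (f := fun p ↦ clippedResidual f p * I.1.indicator (1 : ℝ → ℝ) (f p.1))
      (.of_forall (hbd I.1))
  · obtain ⟨I, hI, hord⟩ := I
    obtain ⟨u, hu⟩ := hord.exists_seq_rat_tendsto_indicator (bddAbove_Icc.mono hI)
      (bddBelow_Icc.mono hI)
    have hlim (p : 𝒳 × ℝ) : Tendsto (fun k ↦ cutoffClass f (u k) p) atTop
        (𝓝 (clippedResidual f p * I.indicator 1 (f p.1))) :=
      (hu (f p.1)).const_mul _
    have hpop : Tendsto (fun k ↦ ∫ p, cutoffClass f (u k) p ∂P) atTop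
        (𝓝 (∫ p, clippedResidual f p * I.indicator 1 (f p.1) ∂P)) :=
      tendsto_integral_of_dominated_convergence (fun _ ↦ 1)
        (fun k ↦ (measurable_cutoffClass hf _).aestronglyMeasurable) (integrable_const _)
        (fun k ↦ .of_forall fun p ↦ abs_cutoffClass_le_one hf01 _ p) (.of_forall hlim)
    have hemp := (tendsto_finsetSum Finset.univ fun i _ ↦ hlim (data i)).const_mul (n : ℝ)⁻¹
    exact le_of_tendsto (hemp.sub hpop).abs (.of_forall fun k ↦
      le_ciSup (bddAbove_deviation (abs_cutoffClass_le_one hf01) data) (u k))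

lemma integral_uniformDeviation_cutoffClass_le (P : Measure (𝒳 × ℝ)) [IsProbabilityMeasure P]
    {f : 𝒳 → ℝ} (hf : Measurable f) (hf01 : ∀ x, f x ∈ Icc (0 : ℝ) 1) {n : ℕ} (hn : 0 < n) :
    ∫ x, uniformDeviation P (cutoffClass f) x ∂(Measure.pi fun _ : Fin n ↦ P) ≤ 8 / √n := by
  refine (integral_uniformDeviation_le (C := 4 * √n) (measurable_cutoffClass hf)
    (abs_cutoffClass_le_one hf01) hn fun x ↦ ?_).trans (le_of_eq ?_)
  · exact sum_iSup_rademacher_le (fun i ↦ f (x i).1) (fun i ↦ clippedResidual f (x i))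
      fun i ↦ abs_clippedResidual_le_one hf01 _
  · have hn' : (0 : ℝ) < n := by exact_mod_cast hn
    rw [div_eq_div_iff hn'.ne' (by positivity)]
    linear_combination 8 * Real.mul_self_sqrt hn'.le

end Cutoff

/-- For i.i.d. data from `P` with `Y ∈ [0,1]` and a fixed measurable `f : 𝒳 → [0,1]`,
with probability at least `1 − δ`,
`|Δ̂_Cutoff(f) − Δ_Cutoff(f)| ≤ (20 + √(2·log(1/δ)))/√n`. -/
theorem empCutoff_concentration {𝒳 : Type*} [MeasurableSpace 𝒳]
    (P : Measure (𝒳 × ℝ)) [IsProbabilityMeasure P]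
    (hY : ∀ᵐ p ∂P, p.2 ∈ Icc (0:ℝ) 1)
    (f : 𝒳 → ℝ) (hf : Measurable f) (hf01 : ∀ x, f x ∈ Icc (0:ℝ) 1)
    (n : ℕ) (hn : 0 < n) (δ : ℝ) (hδ : 0 < δ) :
    ENNReal.ofReal (1 - δ) ≤
      (Measure.pi fun _ : Fin n => P)
        {data | |empCutoff f data - cutoffCEP P f|
          ≤ (20 + Real.sqrt (2 * Real.log (1/δ))) / Real.sqrt n} := by
  rcases le_or_gt 1 δ with h1 | h1
  · simp [ENNReal.ofReal_of_nonpos (sub_nonpos.2 h1)]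
  have hn' : (0 : ℝ) < n := by exact_mod_cast hn
  have hlog : 0 ≤ 2 * Real.log (1 / δ) :=
    mul_nonneg zero_le_two (Real.log_nonneg ((one_le_div hδ).2 h1.le))
  set μ := Measure.pi fun _ : Fin n ↦ P
  set g : (Fin n → 𝒳 × ℝ) → ℝ := uniformDeviation P (cutoffClass f) with hg
  set t := √(2 * Real.log (1 / δ)) / √n with ht
  have hgm : Measurable g := measurable_uniformDeviation (measurable_cutoffClass hf)
  have hsub := hasSubgaussianMGF_of_bounded_differences P (2 / n : ℝ≥0) 2 n g hgm
    (abs_uniformDeviation_le_two (abs_cutoffClass_le_one hf01)) (by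
      simpa using uniformDeviation_sub_update_le (P := P) (abs_cutoffClass_le_one hf01))
  have htail : μ.real {x | t ≤ g x - ∫ y, g y ∂μ} ≤ δ := by
    refine (hsub.measure_ge_le (by positivity)).trans (le_of_eq ?_)
    have hexp : -t ^ 2 / (2 * ((n * (2 / n / 2) ^ 2 : ℝ≥0) : ℝ)) = Real.log δ := by
      rw [ht, div_pow, Real.sq_sqrt hlog, Real.sq_sqrt hn'.le, one_div, Real.log_inv]
      push_cast
      field_simp
    rw [hexp, Real.exp_log hδ]
  have hgood : ∀ᵐ x ∂μ, ∀ i, (x i).2 ∈ Icc (0 : ℝ) 1 :=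
    eventually_all.2 fun i ↦ (Measure.tendsto_eval_ae_ae (μ := fun _ : Fin n ↦ P) (i := i)).eventually hY
  have hms : MeasurableSet {x | t ≤ g x - ∫ y, g y ∂μ} :=
    measurableSet_le measurable_const (hgm.sub_const _)
  calc ENNReal.ofReal (1 - δ) ≤ ENNReal.ofReal (μ.real {x | t ≤ g x - ∫ y, g y ∂μ}ᶜ) := by
        rw [probReal_compl_eq_one_sub hms]
        gcongr
    _ = μ {x | t ≤ g x - ∫ y, g y ∂μ}ᶜ := ofReal_measureReal
    _ ≤ _ := by
      refine measure_mono_ae ?_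
      filter_upwards [hgood] with x hx hxt
      have hlt : g x - ∫ y, g y ∂μ < t := not_le.1 hxt
      have hmean : ∫ y, g y ∂μ ≤ 8 / √n := integral_uniformDeviation_cutoffClass_le P hf hf01 hn
      have h20 : 8 / √(n : ℝ) ≤ 20 / √n := by gcongr; norm_num
      change |empCutoff f x - cutoffCEP P f| ≤ _
      rw [add_div]
      linarith [abs_empCutoff_sub_cutoffCEP_le (P := P) hY hf hf01 x hx]
end

section
/- Consider the two-stage procedure: given i.i.d. data (X₁,Y₁),…,(Xₙ,Yₙ) ~ P with Y ∈ [0,1], a threshold c > 0, δ ∈ (0,1), and an arbitrary model-fitting algorithm 𝒜, train f_init = 𝒜((X₁,Y₁),…,(X_⌈n/2⌉,Y_⌈n/2⌉)) on the first half; compute Δ̂_Cutoff(f_init) := sup over intervals I of |(1/⌊n/2⌋)·Σ_{i=⌈n/2⌉+1}^n (Y_i − f_init(X_i))·1{f_init(X_i) ∈ I}| on the second half; return f_n = f_init if Δ̂_Cutoff(f_init) ≤ c − (20 + √(2·log(1/δ)))/√⌊n/2⌋, and otherwise return the constant function f_n ≡ (1/⌊n/2⌋)·Σ_{i=⌈n/2⌉+1}^n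 Y_i. Then for any distribution P and any algorithm 𝒜, provided c ≥ √(log(1/δ)/(2⌊n/2⌋)), it holds that ℙ{Δ_Cutoff^P(f_n) ≤ c} ≥ 1 − 2δ. -/
open MeasureTheory Set

open ProbabilityTheory

/-- **Hoeffding's inequality** for the mean of an i.i.d. sample of a bounded function. -/
lemma measureReal_pi_le_mean_sub_integral {Ω : Type*} [MeasurableSpace Ω] (P : Measure Ω)
    [IsProbabilityMeasure P] {Z : Ω → ℝ} (hZ : Measurable Z) {a b : ℝ} (hab : a < b)
    (hZab : ∀ᵐ ω ∂P, Z ω ∈ Icc a b) {m : ℕ} (hm : 0 < m) {s : ℝ} (hs : 0 ≤ s) :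
    (Measure.pi fun _ : Fin m => P).real {d | s ≤ (m : ℝ)⁻¹ * ∑ i, Z (d i) - ∫ ω, Z ω ∂P} ≤
      Real.exp (-(2 * m * s ^ 2 / (b - a) ^ 2)) := by
  have hm' : (0 : ℝ) < m := by exact_mod_cast hm
  have hsub := hasSubgaussianMGF_of_mem_Icc hZ.aemeasurable hZab
  have hindep : iIndepFun (fun (i : Fin m) (d : Fin m → Ω) => Z (d i) - ∫ ω, Z ω ∂P)
      (Measure.pi fun _ : Fin m => P) :=
    iIndepFun_pi (X := fun _ ω => Z ω - ∫ ω, Z ω ∂P) fun _ => (hZ.sub_const _).aemeasurable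
  have hsubi : ∀ i ∈ (Finset.univ : Finset (Fin m)), HasSubgaussianMGF
      (fun d : Fin m → Ω => Z (d i) - ∫ ω, Z ω ∂P) ((‖b - a‖₊ / 2) ^ 2)
      (Measure.pi fun _ : Fin m => P) := by
    intro i _
    refine HasSubgaussianMGF.of_map (Y := fun d : Fin m → Ω => d i)
      (X := fun ω => Z ω - ∫ ω, Z ω ∂P) (measurable_pi_apply i).aemeasurable ?_
    rwa [(measurePreserving_eval (fun _ : Fin m => P) i).map_eq]
  have key := HasSubgaussianMGF.measure_sum_ge_le_of_iIndepFun hindep hsubi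
    (mul_nonneg hm'.le hs)
  convert key using 2
  · congr 1
    ext d
    simp only [Finset.sum_sub_distrib, Finset.sum_const, Finset.card_univ,
      Fintype.card_fin, nsmul_eq_mul]
    rw [← mul_le_mul_iff_right₀ hm', mul_sub, mul_inv_cancel_left₀ hm'.ne']
  · have : b - a ≠ 0 := (sub_pos.2 hab).ne'
    simp only [Finset.sum_const, Finset.card_univ, Fintype.card_fin, nsmul_eq_mul,
      NNReal.coe_mul, NNReal.coe_pow, NNReal.coe_div, coe_nnnorm, NNReal.coe_natCast,
      NNReal.coe_ofNat, Real.norm_eq_abs, div_pow, sq_abs]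
    field_simp

/-- Two-sided version of **Hoeffding's inequality** for the mean of an i.i.d. sample. -/
lemma measureReal_pi_lt_abs_mean_sub_integral {Ω : Type*} [MeasurableSpace Ω] (P : Measure Ω)
    [IsProbabilityMeasure P] {Z : Ω → ℝ} (hZ : Measurable Z) {a b : ℝ} (hab : a < b)
    (hZab : ∀ᵐ ω ∂P, Z ω ∈ Icc a b) {m : ℕ} (hm : 0 < m) {s : ℝ} (hs : 0 ≤ s) :
    (Measure.pi fun _ : Fin m => P).real {d | s < |(m : ℝ)⁻¹ * ∑ i, Z (d i) - ∫ ω, Z ω ∂P|} ≤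
      2 * Real.exp (-(2 * m * s ^ 2 / (b - a) ^ 2)) := by
  have h₁ := measureReal_pi_le_mean_sub_integral P hZ hab hZab hm hs
  have h₂ := measureReal_pi_le_mean_sub_integral P hZ.neg (neg_lt_neg hab)
    (hZab.mono fun ω h => (⟨neg_le_neg h.2, neg_le_neg h.1⟩ : -Z ω ∈ Icc (-b) (-a))) hm hs
  rw [show -a - -b = b - a by ring] at h₂
  rw [two_mul]
  refine le_trans (measureReal_mono ?_) ((measureReal_union_le _ _).trans (add_le_add h₁ h₂))
  intro d hd
  simp only [mem_ofPred_eq, lt_abs, mem_union, Pi.neg_apply, Finset.sum_neg_distrib,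
    integral_neg] at hd ⊢
  rcases hd with hd | hd
  · exact Or.inl hd.le
  · exact Or.inr (by linarith)

/-- Lower bounds on all slices bound the (outer) measure of a possibly non-measurable set. -/
lemma le_measure_pi_of_forall_slice {Ω : Type*} [MeasurableSpace Ω] (P : Measure Ω)
    [IsProbabilityMeasure P] {k m n : ℕ} (hkm : k + m = n) (S : Set (Fin n → Ω)) (r : ENNReal)
    (hS : ∀ u : Fin k → Ω, r ≤ (Measure.pi fun _ : Fin m => P)
      {v | ∃ d ∈ S, (∀ i : Fin k, d ⟨i.1, by have := i.isLt; omega⟩ = u i) ∧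
        ∀ j : Fin m, d ⟨k + j.1, by have := j.isLt; omega⟩ = v j}) :
    r ≤ (Measure.pi fun _ : Fin n => P) S := by
  let e : Fin k ⊕ Fin m ≃ Fin n := finSumFinEquiv.trans (finCongr hkm)
  let Φ : (Fin k → Ω) × (Fin m → Ω) → Fin n → Ω := fun p =>
    MeasurableEquiv.piCongrLeft (fun _ => Ω) e
      ((MeasurableEquiv.sumPiEquivProdPi fun _ : Fin k ⊕ Fin m => Ω).symm p)
  have hΦ : MeasurePreserving Φ
      ((Measure.pi fun _ : Fin k => P).prod (Measure.pi fun _ : Fin m => P))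
      (Measure.pi fun _ : Fin n => P) :=
    (measurePreserving_piCongrLeft (fun _ : Fin n => P) e).comp
      (measurePreserving_sumPiEquivProdPi_symm fun _ : Fin k ⊕ Fin m => P)
  have hΦe : ∀ d p, Φ p = d → ∀ i,
      d (e i) = (MeasurableEquiv.sumPiEquivProdPi fun _ : Fin k ⊕ Fin m => Ω).symm p i := by
    rintro _ p rfl i
    exact Equiv.piCongrLeft_apply_apply (fun _ => Ω) e _ i
  have hT := measurableSet_toMeasurable (Measure.pi fun _ : Fin n => P) S
  rw [← measure_toMeasurable S, ← hΦ.measure_preimage hT.nullMeasurableSet,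
    Measure.prod_apply (hΦ.measurable hT)]
  calc r = ∫⁻ _ : Fin k → Ω, r ∂(Measure.pi fun _ : Fin k => P) := by simp
    _ ≤ _ := lintegral_mono fun u => (hS u).trans (measure_mono ?_)
  rintro v ⟨d, hd, hu, hv⟩
  have : Φ (u, v) = d := by
    ext i
    obtain ⟨i, rfl⟩ := e.surjective i
    rw [hΦe _ _ rfl i]
    rcases i with i | j
    · exact (hu i).symm
    · exact (hv j).symm
  exact subset_toMeasurable _ _ (by rwa [this])

lemma ofReal_one_sub_le_measure_of_compl_subset {Ω : Type*} [MeasurableSpace Ω] {μ : Measure Ω}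
    [IsProbabilityMeasure μ] {B S : Set Ω} {r : ℝ} (hB : MeasurableSet B) (hBr : μ.real B ≤ r)
    (hBS : Bᶜ ⊆ S) : ENNReal.ofReal (1 - r) ≤ μ S := by
  refine le_trans ?_ (measure_mono hBS)
  rw [← ofReal_measureReal, probReal_compl_eq_one_sub hB]
  exact ENNReal.ofReal_le_ofReal (by linarith)

lemma abs_mean_le_empCutoff {𝒳 : Type*} (f : 𝒳 → ℝ) {m : ℕ} (d : Fin m → 𝒳 × ℝ)
    {I : Set ℝ} (hI : I ⊆ Icc 0 1) (hI' : I.OrdConnected) :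
    |(m : ℝ)⁻¹ * ∑ i, ((d i).2 - f (d i).1) * I.indicator (1 : ℝ → ℝ) (f (d i).1)| ≤
      empCutoff f d := by
  refine le_ciSup (f := fun I : {I : Set ℝ // I ⊆ Icc 0 1 ∧ I.OrdConnected} =>
    |(m : ℝ)⁻¹ * ∑ i, ((d i).2 - f (d i).1) * I.1.indicator (1 : ℝ → ℝ) (f (d i).1)|)
    ⟨(m : ℝ)⁻¹ * ∑ i, |(d i).2 - f (d i).1|, ?_⟩ ⟨I, hI, hI'⟩
  rintro _ ⟨J, rfl⟩
  simp only [abs_mul, abs_inv, Nat.abs_cast]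
  gcongr
  refine (Finset.abs_sum_le_sum_abs _ _).trans (Finset.sum_le_sum fun i _ => ?_)
  rw [abs_mul]
  refine mul_le_of_le_one_right (abs_nonneg _) ?_
  by_cases h : f (d i).1 ∈ J.1 <;> simp [h]

lemma empCutoff_nonneg {𝒳 : Type*} (f : 𝒳 → ℝ) {m : ℕ} (d : Fin m → 𝒳 × ℝ) :
    0 ≤ empCutoff f d :=
  Real.iSup_nonneg fun _ => abs_nonneg _

/-- The cutoff calibration error of a constant is at most its distance to the mean label. -/
lemma cutoffCEP_const_le {𝒳 : Type*} [MeasurableSpace 𝒳] (P : Measure (𝒳 × ℝ))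
    [IsProbabilityMeasure P] (hY : ∀ᵐ p ∂P, p.2 ∈ Icc (0:ℝ) 1) (g : ℝ) :
    cutoffCEP P (fun _ => g) ≤ |g - ∫ p, p.2 ∂P| := by
  have : Nonempty {I : Set ℝ // I ⊆ Icc 0 1 ∧ I.OrdConnected} :=
    ⟨⟨∅, empty_subset _, ordConnected_empty⟩⟩
  refine ciSup_le fun I => ?_
  by_cases h : g ∈ I.1
  · have hint : Integrable (fun p : 𝒳 × ℝ => p.2) P :=
      Integrable.of_mem_Icc 0 1 measurable_snd.aemeasurable hY
    simp [h, integral_sub hint (integrable_const g), abs_sub_comm]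
  · simp [h]

/-- If the cutoff calibration error of `f` exceeds `c`, the estimator falls `s` below `c` with
probability at most `exp (-m s² / 2)`. -/
lemma exists_measurableSet_empCutoff_le {𝒳 : Type*} [MeasurableSpace 𝒳] (P : Measure (𝒳 × ℝ))
    [IsProbabilityMeasure P] (hY : ∀ᵐ p ∂P, p.2 ∈ Icc (0:ℝ) 1) {m : ℕ} (hm : 0 < m)
    {f : 𝒳 → ℝ} (hf : Measurable f) (hf01 : ∀ x, f x ∈ Icc (0:ℝ) 1) {c s : ℝ} (hs : 0 ≤ s)
    (hc : c < cutoffCEP P f) :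
    ∃ B : Set (Fin m → 𝒳 × ℝ), MeasurableSet B ∧
      (Measure.pi fun _ : Fin m => P).real B ≤ Real.exp (-(m * s ^ 2 / 2)) ∧
      ∀ d, empCutoff f d ≤ c - s → d ∈ B := by
  have : Nonempty {I : Set ℝ // I ⊆ Icc 0 1 ∧ I.OrdConnected} :=
    ⟨⟨∅, empty_subset _, ordConnected_empty⟩⟩
  obtain ⟨⟨I, hI, hI'⟩, hcI⟩ := exists_lt_of_lt_ciSup hc
  have hW : Measurable fun p : 𝒳 × ℝ => (p.2 - f p.1) * I.indicator (1 : ℝ → ℝ) (f p.1) :=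
    (measurable_snd.sub (hf.comp measurable_fst)).mul
      ((measurable_one.indicator hI'.measurableSet).comp (hf.comp measurable_fst))
  have hW1 : ∀ᵐ p ∂P, (p.2 - f p.1) * I.indicator (1 : ℝ → ℝ) (f p.1) ∈ Icc (-1 : ℝ) 1 := by
    filter_upwards [hY] with p hp
    have := hf01 p.1
    by_cases h : f p.1 ∈ I
    · simp only [h, indicator_of_mem, Pi.one_apply, mul_one]
      exact ⟨by linarith [hp.1, this.2], by linarith [hp.2, this.1]⟩
    · simp [h]
  have hmeas : ∀ Z : 𝒳 × ℝ → ℝ, Measurable Z →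
      MeasurableSet {d : Fin m → 𝒳 × ℝ | s ≤ (m : ℝ)⁻¹ * ∑ i, Z (d i) - ∫ p, Z p ∂P} :=
    fun Z hZ => measurableSet_le measurable_const (by fun_prop)
  have hexp : 2 * (m : ℝ) * s ^ 2 / (1 - -1) ^ 2 = m * s ^ 2 / 2 := by ring
  rcases lt_abs.1 hcI with hpos | hneg
  · refine ⟨_, hmeas _ hW.neg, hexp ▸ measureReal_pi_le_mean_sub_integral P hW.neg
      (a := -1) (b := 1) (by norm_num) ?_ hm hs, fun d hd => ?_⟩
    · filter_upwards [hW1] with p hp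
      exact ⟨neg_le_neg hp.2, by simpa using neg_le_neg hp.1⟩
    · have := (le_abs_self _).trans ((abs_mean_le_empCutoff f d hI hI').trans hd)
      simp only [mem_ofPred_eq, Pi.neg_apply, Finset.sum_neg_distrib, integral_neg]
      simp only at hpos
      linarith
  · refine ⟨_, hmeas _ hW, hexp ▸ measureReal_pi_le_mean_sub_integral P hW
      (a := -1) (b := 1) (by norm_num) hW1 hm hs, fun d hd => ?_⟩
    have := (neg_abs_le _).trans' (neg_le_neg ((abs_mean_le_empCutoff f d hI hI').trans hd))
    simp only [mem_ofPred_eq]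
    simp only at hneg
    linarith

/-- The guarantee of the second stage for a fixed initial model. -/
lemma second_stage_guarantee {𝒳 : Type*} [MeasurableSpace 𝒳] (P : Measure (𝒳 × ℝ))
    [IsProbabilityMeasure P] (hY : ∀ᵐ p ∂P, p.2 ∈ Icc (0:ℝ) 1) {m : ℕ} (hm : 0 < m)
    {f : 𝒳 → ℝ} (hf : Measurable f) (hf01 : ∀ x, f x ∈ Icc (0:ℝ) 1) {c δ : ℝ} (hc : 0 < c)
    (hδ0 : 0 < δ) (hδ1 : δ < 1) (hcn : Real.sqrt (Real.log (1/δ) / (2 * m)) ≤ c) :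
    ENNReal.ofReal (1 - 2*δ) ≤ (Measure.pi fun _ : Fin m => P) {d |
      cutoffCEP P
        (if empCutoff f d ≤ c - (20 + Real.sqrt (2 * Real.log (1/δ))) / Real.sqrt m then f
          else fun _ => (m : ℝ)⁻¹ * ∑ j, (d j).2) ≤ c} := by
  set L := Real.log (1/δ) with hL
  set s := (20 + Real.sqrt (2 * L)) / Real.sqrt m with hs
  have hm' : (0 : ℝ) < m := by exact_mod_cast hm
  have hL0 : 0 ≤ L := Real.log_nonneg (by rw [le_div_iff₀ hδ0]; linarith)
  have hexpL : Real.exp (-L) = δ := by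
    rw [hL, one_div, Real.log_inv, neg_neg, Real.exp_log hδ0]
  have hs0 : 0 ≤ s := by positivity
  have hms : 400 + 2 * L ≤ m * s ^ 2 := by
    rw [hs, div_pow, Real.sq_sqrt hm'.le, mul_div_cancel₀ _ hm'.ne']
    nlinarith [Real.sq_sqrt (mul_nonneg zero_le_two hL0), Real.sqrt_nonneg (2 * L)]
  have hmc : L ≤ 2 * m * c ^ 2 := by
    have := (Real.sqrt_le_left hc.le).1 hcn
    rw [div_le_iff₀ (by positivity)] at this
    linarith
  let M : Set (Fin m → 𝒳 × ℝ) := {d | c < |(m : ℝ)⁻¹ * ∑ j, (d j).2 - ∫ p, p.2 ∂P|}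
  have hM : MeasurableSet M := measurableSet_lt measurable_const (by fun_prop)
  have hMP : (Measure.pi fun _ : Fin m => P).real M ≤ 2 * Real.exp (-(2 * m * c ^ 2)) := by
    simpa using measureReal_pi_lt_abs_mean_sub_integral P measurable_snd zero_lt_one hY hm hc.le
  have hconst : ∀ d ∉ M, cutoffCEP P (fun _ => (m : ℝ)⁻¹ * ∑ j, (d j).2) ≤ c := fun d hd =>
    (cutoffCEP_const_le P hY _).trans (not_lt.1 hd)
  by_cases hcase : cutoffCEP P f ≤ c ∨ c < s
  · refine ofReal_one_sub_le_measure_of_compl_subset hM (hMP.trans ?_) fun d hd => ?_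
    · rw [← hexpL]
      gcongr
    · rw [mem_ofPred_eq]
      split_ifs with h
      · rcases hcase with h' | h'
        · exact h'
        · linarith [empCutoff_nonneg f d]
      · exact hconst d hd
  · obtain ⟨hcf, hsc⟩ : c < cutoffCEP P f ∧ s ≤ c := by simpa using hcase
    obtain ⟨B, hB, hBP, hBd⟩ := exists_measurableSet_empCutoff_le P hY hm hf hf01 hs0 hcf
    refine ofReal_one_sub_le_measure_of_compl_subset (hB.union hM)
      ((measureReal_union_le _ _).trans ?_) fun d hd => ?_
    · have h₁ : Real.exp (-(m * s ^ 2 / 2)) ≤ δ := by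
        rw [← hexpL, Real.exp_le_exp]
        linarith
      have h₂ : 2 * Real.exp (-(2 * m * c ^ 2)) ≤ δ := by
        have hsq : m * s ^ 2 ≤ m * c ^ 2 := by gcongr
        have h2 : (2 : ℝ) ≤ Real.exp 1 := by linarith [Real.add_one_le_exp (1 : ℝ)]
        calc 2 * Real.exp (-(2 * m * c ^ 2))
            ≤ Real.exp 1 * Real.exp (-(2 * m * c ^ 2)) := by gcongr
          _ = Real.exp (1 - 2 * m * c ^ 2) := by rw [← Real.exp_add, sub_eq_add_neg]
          _ ≤ Real.exp (-L) := Real.exp_le_exp.2 (by linarith)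
          _ = δ := hexpL
      linarith
    · rw [mem_ofPred_eq]
      split_ifs with h
      · exact absurd (Or.inl (hBd d h)) hd
      · exact hconst d fun h' => hd (Or.inr h')

/-- The two-stage procedure: train `f_init = 𝒜(first ⌈n/2⌉ points)`; estimate its cutoff
calibration error on the remaining ⌊n/2⌋ points; return `f_init` if
`Δ̂_Cutoff(f_init) ≤ c − (20 + √(2·log(1/δ)))/√⌊n/2⌋`, else return the constant function
equal to the second-half empirical mean of `Y`. Then, for any distribution `P` and any
algorithm `𝒜`, provided `c ≥ √(log(1/δ)/(2⌊n/2⌋))`, we have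
`ℙ{Δ_Cutoff^P(f_n) ≤ c} ≥ 1 − 2δ`. -/
theorem two_stage_guarantee {𝒳 : Type*} [MeasurableSpace 𝒳]
    (P : Measure (𝒳 × ℝ)) [IsProbabilityMeasure P]
    (hY : ∀ᵐ p ∂P, p.2 ∈ Icc (0:ℝ) 1)
    (n : ℕ) (hn : 0 < n / 2)
    (A : (Fin ((n+1)/2) → 𝒳 × ℝ) → 𝒳 → ℝ)
    (hAmeas : ∀ d, Measurable (A d)) (hA01 : ∀ d x, A d x ∈ Icc (0:ℝ) 1)
    (c δ : ℝ) (hc : 0 < c) (hδ0 : 0 < δ) (hδ1 : δ < 1)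
    (hcn : Real.sqrt (Real.log (1/δ) / (2 * (n/2 : ℕ))) ≤ c) :
    ENNReal.ofReal (1 - 2*δ) ≤
      (Measure.pi fun _ : Fin n => P) {data |
        cutoffCEP P
          (if empCutoff (A fun i => data ⟨i.1, by have := i.isLt; omega⟩)
                (fun j : Fin (n/2) => data ⟨(n+1)/2 + j.1, by have := j.isLt; omega⟩)
              ≤ c - (20 + Real.sqrt (2 * Real.log (1/δ))) / Real.sqrt (n/2 : ℕ)
           then A fun i => data ⟨i.1, by have := i.isLt; omega⟩
           else fun _ => ((n/2 : ℕ) : ℝ)⁻¹ *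
             ∑ j : Fin (n/2), (data ⟨(n+1)/2 + j.1, by have := j.isLt; omega⟩).2)
          ≤ c} := by
  refine le_measure_pi_of_forall_slice P (k := (n + 1) / 2) (m := n / 2) (by omega) _ _ fun u =>
    (second_stage_guarantee P hY hn (hAmeas u) (hA01 u) hc hδ0 hδ1 hcn).trans
      (measure_mono fun v hv => ?_)
  refine ⟨fun i => if h : i.1 < (n + 1) / 2 then u ⟨i.1, h⟩
    else v ⟨i.1 - (n + 1) / 2, by have := i.isLt; omega⟩, ?_, by simp, by simp⟩
  simpa using hv
end
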